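/- arXiv:2510.04130 — 3 statements merged into one kernel-verified Lean document; each statement's English description precedes it below -/
import Mathlib

section
/- Let I be a finite nonempty index set and let A : I → ℝ be a real-valued tensor. Then LRC(A) equals the number of distinct nonzero values among the entries of A, i.e. LRC(A) = |{A_i : i ∈ I, A_i ≠ 0}|. -/
/-- The Linear Representation Complexity of a real-valued tensor `A : I → ℝ`:
the minimal `K` such that `A` is a linear combination of `K` pairwise disjoint
`{0,1}`-valued tensors. -/
noncomputable def LRC {I : Type*} (A : I → ℝ) : ℕ :=
  sInf {K : ℕ | ∃ (U : Fin K → I → ℝ) (a : Fin K → ℝ),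
    (∀ k i, U k i = 0 ∨ U k i = 1) ∧
    (∀ k k' : Fin K, k ≠ k' → ∀ i, ¬(U k i = 1 ∧ U k' i = 1)) ∧
    (∀ i, A i = ∑ k, a k * U k i)}

/-- A linear combination of pairwise disjoint `{0,1}`-valued tensors takes, at each index,
either the value zero or one of the coefficients. -/
theorem sum_mul_disjoint_eq_zero_or_coeff {I : Type*} {K : ℕ} (U : Fin K → I → ℝ)
    (a : Fin K → ℝ) (hU : ∀ k i, U k i = 0 ∨ U k i = 1)
    (hdisj : ∀ k k' : Fin K, k ≠ k' → ∀ i, ¬(U k i = 1 ∧ U k' i = 1)) (i : I) :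
    ∑ k, a k * U k i = 0 ∨ ∃ k, ∑ k, a k * U k i = a k := by
  by_cases h : ∃ k, U k i = 1
  · obtain ⟨k, hk⟩ := h
    refine Or.inr ⟨k, ?_⟩
    rw [Finset.sum_eq_single k, hk, mul_one]
    · intro k' _ hne
      rw [(hU k' i).resolve_right fun hk' => hdisj k' k hne i ⟨hk', hk⟩, mul_zero]
    · simp
  · push Not at h
    exact Or.inl (Finset.sum_eq_zero fun k _ => by
      rw [(hU k i).resolve_right (h k), mul_zero])

/-- For a tensor over a finite nonempty index set, the LRC equals the number of
distinct nonzero values among its entries. -/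
theorem LRC_eq_card_distinct_nonzero_values {I : Type*} [Fintype I] [Nonempty I]
    (A : I → ℝ) :
    LRC A = (Finset.image A Finset.univ \ {(0 : ℝ)}).card := by
  set S := Finset.image A Finset.univ \ {(0 : ℝ)} with hS
  have hmem : ∃ (U : Fin S.card → I → ℝ) (a : Fin S.card → ℝ),
      (∀ k i, U k i = 0 ∨ U k i = 1) ∧
      (∀ k k' : Fin S.card, k ≠ k' → ∀ i, ¬(U k i = 1 ∧ U k' i = 1)) ∧
      (∀ i, A i = ∑ k, a k * U k i) := by
    refine ⟨fun k i => if A i = S.equivFin.symm k then 1 else 0,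
      fun k => S.equivFin.symm k, ?_, ?_, ?_⟩
    · intro k i
      dsimp only
      split_ifs <;> simp
    · rintro k k' hne i ⟨h, h'⟩
      have hk : A i = S.equivFin.symm k := by
        by_contra hc
        simp [hc] at h
      have hk' : A i = S.equivFin.symm k' := by
        by_contra hc
        simp [hc] at h'
      exact hne (S.equivFin.symm.injective (Subtype.ext (hk.symm.trans hk')))
    · intro i
      rw [Equiv.sum_comp S.equivFin.symm fun s : S => (s : ℝ) * if A i = s then 1 else 0,
        Finset.sum_coe_sort S fun s : ℝ => s * if A i = s then 1 else 0]
      by_cases h : A i = 0 <;> simp [hS, h]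
  refine le_antisymm (Nat.sInf_le hmem) (le_csInf ⟨_, hmem⟩ ?_)
  rintro K ⟨U, a, hU, hdisj, hA⟩
  have hsub : S ⊆ Finset.image a Finset.univ := by
    intro x hx
    simp only [hS, Finset.mem_sdiff, Finset.mem_image, Finset.mem_univ, true_and,
      Finset.mem_singleton] at hx ⊢
    obtain ⟨⟨i, rfl⟩, hne⟩ := hx
    rcases sum_mul_disjoint_eq_zero_or_coeff U a hU hdisj i with h | ⟨k, h⟩
    · exact absurd ((hA i).trans h) hne
    · exact ⟨k, ((hA i).trans h).symm⟩
  calc S.card ≤ (Finset.image a Finset.univ).card := Finset.card_le_card hsub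
    _ ≤ (Finset.univ : Finset (Fin K)).card := Finset.card_image_le
    _ = K := by simp
end

section
/- Let N0 < N be positive integers and let B0 be an N0×N0 upper triangular real matrix. Then the set F̄ of all N×N upper triangular real matrices A whose top-left [N0]×[N0] block equals B0 and which satisfy LRC_{N0}(A) = LRC(A) is a finite set; consequently, F̄ has Hausdorff dimension 0 as a subset of ℝ^{N×N}. -/
open MeasureTheory

/-- An `N×N` real matrix (as a function) is upper triangular if all entries
strictly below the diagonal vanish. -/
def UpperTri {n : ℕ} (A : Fin n → Fin n → ℝ) : Prop :=
  ∀ i j : Fin n, (j : ℕ) < (i : ℕ) → A i j = 0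

/-- The LRC of a matrix, viewing it as a tensor indexed by pairs. -/
noncomputable def matLRC {N : ℕ} (A : Fin N → Fin N → ℝ) : ℕ :=
  LRC (fun p : Fin N × Fin N => A p.1 p.2)

/-- `LRC_{N0}(A)`: the minimum of `LRC A'` over all upper triangular `A' ∈ U_N`
whose top-left `[N0]×[N0]` block equals that of `A`. -/
noncomputable def LRCtrunc (N0 N : ℕ) (h : N0 ≤ N) (A : Fin N → Fin N → ℝ) : ℕ :=
  sInf {K : ℕ | ∃ A' : Fin N → Fin N → ℝ, UpperTri A' ∧
    (∀ i j : Fin N0,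
      A' (Fin.castLE h i) (Fin.castLE h j) = A (Fin.castLE h i) (Fin.castLE h j)) ∧
    matLRC A' = K}

/-- A tensor is represented by the indicators of its distinct nonzero values. -/
theorem exists_disjoint_representation {I : Type*} [Fintype I] (A : I → ℝ) :
    ∃ (U : Fin ((Finset.univ.image A).erase 0).card → I → ℝ)
      (a : Fin ((Finset.univ.image A).erase 0).card → ℝ),
      (∀ k i, U k i = 0 ∨ U k i = 1) ∧
      (∀ k k', k ≠ k' → ∀ i, ¬(U k i = 1 ∧ U k' i = 1)) ∧
      (∀ i, A i = ∑ k, a k * U k i) := by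
  classical
  set S := (Finset.univ.image A).erase 0 with hS
  refine ⟨fun k i => if A i = (S.equivFin.symm k : ℝ) then 1 else 0,
    fun k => (S.equivFin.symm k : ℝ), ?_, ?_, ?_⟩
  · intro k i
    dsimp only
    split_ifs <;> simp
  · rintro k k' hkk i ⟨h, h'⟩
    have e : A i = (S.equivFin.symm k : ℝ) := by by_contra hn; simp [hn] at h
    have e' : A i = (S.equivFin.symm k' : ℝ) := by by_contra hn; simp [hn] at h'
    exact hkk (S.equivFin.symm.injective (Subtype.ext (e.symm.trans e')))
  · intro i
    rw [Equiv.sum_comp S.equivFin.symm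
      (fun s : S => (s : ℝ) * if A i = (s : ℝ) then 1 else 0),
      Finset.sum_coe_sort S (fun s : ℝ => s * if A i = s then 1 else 0)]
    simp only [mul_ite, mul_one, mul_zero, Finset.sum_ite_eq]
    by_cases h : A i = 0 <;> simp [hS, h]

/-- The coefficients of a disjoint representation exhaust the nonzero values of the tensor. -/
theorem card_nonzero_values_le {I : Type*} [Fintype I] {A : I → ℝ} {K : ℕ}
    {U : Fin K → I → ℝ} {a : Fin K → ℝ} (h01 : ∀ k i, U k i = 0 ∨ U k i = 1)
    (hdisj : ∀ k k' : Fin K, k ≠ k' → ∀ i, ¬(U k i = 1 ∧ U k' i = 1))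
    (hA : ∀ i, A i = ∑ k, a k * U k i) :
    ((Finset.univ.image A).erase 0).card ≤ K := by
  have hsub : (Finset.univ.image A).erase 0 ⊆ Finset.univ.image a := by
    intro x hx
    obtain ⟨hx0, hx⟩ := Finset.mem_erase.mp hx
    obtain ⟨i, -, rfl⟩ := Finset.mem_image.mp hx
    rw [hA i] at hx0
    obtain ⟨k, -, hk⟩ := Finset.exists_ne_zero_of_sum_ne_zero hx0
    have hk1 : U k i = 1 := (h01 k i).resolve_left (right_ne_zero_of_mul hk)
    refine Finset.mem_image.mpr ⟨k, Finset.mem_univ k, ?_⟩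
    rw [hA i, Finset.sum_eq_single k, hk1, mul_one]
    · intro k' _ hne
      rw [(h01 k' i).resolve_right fun h => hdisj k' k hne i ⟨h, hk1⟩, mul_zero]
    · simp
  simpa using (Finset.card_le_card hsub).trans Finset.card_image_le

/-- The LRC of a tensor is the number of its distinct nonzero values. -/
theorem LRC_eq_card {I : Type*} [Fintype I] (A : I → ℝ) :
    LRC A = ((Finset.univ.image A).erase 0).card := by
  refine le_antisymm (Nat.sInf_le (exists_disjoint_representation A))
    (le_csInf ⟨_, exists_disjoint_representation A⟩ ?_)
  rintro K ⟨U, a, h01, hdisj, hA⟩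
  exact card_nonzero_values_le h01 hdisj hA

/-- If the LRC of `A` does not exceed that of its top-left block, then every nonzero entry of `A`
already occurs in that block. -/
theorem exists_eq_of_LRCtrunc_eq {N0 N : ℕ} (h : N0 ≤ N) {A : Fin N → Fin N → ℝ}
    (hA : UpperTri A) (hLRC : LRCtrunc N0 N h A = matLRC A) {i j : Fin N} (hij : A i j ≠ 0) :
    ∃ i' j' : Fin N0, A (Fin.castLE h i') (Fin.castLE h j') = A i j := by
  set Z : Fin N → Fin N → ℝ := fun i j => if (i : ℕ) < N0 ∧ (j : ℕ) < N0 then A i j else 0 with hZ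
  have hle : matLRC A ≤ matLRC Z := by
    rw [← hLRC]
    refine Nat.sInf_le ⟨Z, fun i j hlt => ?_, fun i j => ?_, rfl⟩
    · simp [hZ, hA i j hlt]
    · simp [hZ]
  simp only [matLRC, LRC_eq_card] at hle
  have hsub : (Finset.univ.image fun p : Fin N × Fin N => Z p.1 p.2).erase 0 ⊆
      (Finset.univ.image fun p : Fin N × Fin N => A p.1 p.2).erase 0 := by
    intro x hx
    obtain ⟨hx0, hx⟩ := Finset.mem_erase.mp hx
    obtain ⟨p, -, rfl⟩ := Finset.mem_image.mp hx
    refine Finset.mem_erase.mpr ⟨hx0, Finset.mem_image.mpr ⟨p, Finset.mem_univ p, ?_⟩⟩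
    simp only [hZ] at hx0 ⊢
    exact (if_pos (ite_ne_right_iff.mp hx0).1).symm
  have hmem : A i j ∈ (Finset.univ.image fun p : Fin N × Fin N => Z p.1 p.2).erase 0 := by
    rw [Finset.eq_of_subset_of_card_le hsub hle]
    exact Finset.mem_erase.mpr ⟨hij, Finset.mem_image.mpr ⟨(i, j), Finset.mem_univ _, rfl⟩⟩
  obtain ⟨-, hmem⟩ := Finset.mem_erase.mp hmem
  obtain ⟨⟨k, l⟩, -, hkl⟩ := Finset.mem_image.mp hmem
  rw [← hkl] at hij ⊢
  simp only [hZ] at hij ⊢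
  obtain ⟨hlt, -⟩ := ite_ne_right_iff.mp hij
  exact ⟨⟨k, hlt.1⟩, ⟨l, hlt.2⟩, (if_pos hlt).symm⟩

/-- The set of upper triangular `N×N` matrices whose top-left block is `B0` and
whose LRC does not increase from scale `N0` to scale `N` is finite, hence of
Hausdorff dimension `0` in `ℝ^{N×N}`. -/
theorem nonincreasingLRC_finite_and_dimH_zero (N0 N : ℕ) (h0 : 0 < N0) (hlt : N0 < N)
    (B0 : Fin N0 → Fin N0 → ℝ) (hB0 : UpperTri B0) :
    ({A : Fin N → Fin N → ℝ | UpperTri A ∧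
        (∀ i j : Fin N0, A (Fin.castLE hlt.le i) (Fin.castLE hlt.le j) = B0 i j) ∧
        LRCtrunc N0 N hlt.le A = matLRC A}).Finite ∧
    dimH ({A : Fin N → Fin N → ℝ | UpperTri A ∧
        (∀ i j : Fin N0, A (Fin.castLE hlt.le i) (Fin.castLE hlt.le j) = B0 i j) ∧
        LRCtrunc N0 N hlt.le A = matLRC A}) = 0 := by
  have hfin : {A : Fin N → Fin N → ℝ | UpperTri A ∧
        (∀ i j : Fin N0, A (Fin.castLE hlt.le i) (Fin.castLE hlt.le j) = B0 i j) ∧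
        LRCtrunc N0 N hlt.le A = matLRC A}.Finite := by
    have hT : (insert 0 (Set.range fun p : Fin N0 × Fin N0 => B0 p.1 p.2)).Finite :=
      (Set.finite_range _).insert 0
    refine (Set.Finite.pi' fun _ : Fin N => Set.Finite.pi' fun _ : Fin N => hT).subset ?_
    rintro A ⟨hA, hB, hLRC⟩ i j
    by_cases hij : A i j = 0
    · exact Or.inl hij
    · obtain ⟨i', j', h⟩ := exists_eq_of_LRCtrunc_eq hlt.le hA hLRC hij
      exact Or.inr ⟨(i', j'), (hB i' j').symm.trans h⟩
  exact ⟨hfin, hfin.dimH_zero⟩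
end

section
/- Let N0 ≤ N be positive integers and let A* ∈ U_N be an upper triangular matrix such that every nonzero entry value of A* appears among the entries of its top-left [N0]×[N0] block (equivalently, LRC_{N0}(A*) = LRC(A*)). Then there exist a positive integer S and pairwise disjoint {0,1}-valued matrices U_1, …, U_S ∈ U_N such that: the constraint set Q = {q ∈ ℝ^S : the top-left [N0]×[N0] block of Σ_{s=1}^S q_s U_s equals the top-left [N0]×[N0] block of A*} is nonempty, Q has a unique element q̂ of minimal Euclidean norm, and this minimizer satisfies Σ_{s=1}^S q̂_s U_s = A*. (Hence the POLA model with this position embedding, initialized at 0 and trained by gradient descent—which converges to the minimum-norm interpolator of the training data—achieves (N0,N)-length generalization.) -/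
/-- A sum weighted by the indicators of the nonzero level sets, where `v` enumerates the levels
injectively, picks out the weight of the level of `x`. -/
lemma sum_mul_level_indicator {ι : Type*} [Fintype ι] {v : ι → ℝ} (hv : Function.Injective v)
    (q : ι → ℝ) {s : ι} (hs : v s ≠ 0) :
    ∑ t, q t * (if v t ≠ 0 ∧ v s = v t then (1 : ℝ) else 0) = q s := by
  classical
  rw [Finset.sum_eq_single s]
  · simp [hs]
  · intro t _ hts
    have : v s ≠ v t := fun h => hts (hv h).symm
    simp [this]
  · simp

/-- A vector coordinatewise dominated by `q` and not longer than `q` is reached only if the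
absolute values of all coordinates agree. -/
lemma EuclideanSpace.sq_eq_sq_of_abs_le_of_norm_le {ι : Type*} [Fintype ι]
    {p q : EuclideanSpace ℝ ι} (h : ∀ s, |p s| ≤ |q s|) (hn : ‖q‖ ≤ ‖p‖) (s : ι) :
    p s ^ 2 = q s ^ 2 := by
  have hle : ∀ t ∈ Finset.univ, p t ^ 2 ≤ q t ^ 2 := fun t _ => sq_le_sq.2 (h t)
  have hsum : ∑ t, q t ^ 2 ≤ ∑ t, p t ^ 2 := by
    rw [← EuclideanSpace.real_norm_sq_eq, ← EuclideanSpace.real_norm_sq_eq]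
    gcongr
  exact (Finset.sum_eq_sum_iff_of_le hle).1 (le_antisymm (Finset.sum_le_sum hle) hsum) s
    (Finset.mem_univ s)

/-- Capability of PEs for POLA models: if every nonzero entry value of the upper
triangular target `A*` already appears in its top-left `[N0]×[N0]` block (i.e.
its LRC does not increase from scale `N0` to scale `N`), then there is a
position embedding — pairwise disjoint `{0,1}`-valued indicator matrices
`U_1, …, U_S` — such that the linear constraint set `Q` determined by the
training data (the top-left block) is nonempty, has a unique element of minimal
Euclidean norm, and that minimum-norm interpolator reconstructs `A*` exactly, so
gradient descent from `0` achieves `(N0, N)`-length generalization. -/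
theorem pola_capability (N0 N : ℕ) (h0 : 0 < N0) (hle : N0 ≤ N)
    (A : Fin N → Fin N → ℝ) (hA : UpperTri A)
    (hval : ∀ i j : Fin N, A i j ≠ 0 →
      ∃ i0 j0 : Fin N0, A (Fin.castLE hle i0) (Fin.castLE hle j0) = A i j) :
    ∃ S : ℕ, 0 < S ∧ ∃ U : Fin S → Fin N → Fin N → ℝ,
      (∀ s, UpperTri (U s)) ∧
      (∀ s i j, U s i j = 0 ∨ U s i j = 1) ∧
      (∀ s s' : Fin S, s ≠ s' → ∀ i j, ¬(U s i j = 1 ∧ U s' i j = 1)) ∧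
      ∃ qhat : EuclideanSpace ℝ (Fin S),
        qhat ∈ {q : EuclideanSpace ℝ (Fin S) | ∀ i0 j0 : Fin N0,
          ∑ s, q s * U s (Fin.castLE hle i0) (Fin.castLE hle j0)
            = A (Fin.castLE hle i0) (Fin.castLE hle j0)} ∧
        (∀ q ∈ {q : EuclideanSpace ℝ (Fin S) | ∀ i0 j0 : Fin N0,
          ∑ s, q s * U s (Fin.castLE hle i0) (Fin.castLE hle j0)
            = A (Fin.castLE hle i0) (Fin.castLE hle j0)}, ‖qhat‖ ≤ ‖q‖) ∧
        (∀ q ∈ {q : EuclideanSpace ℝ (Fin S) | ∀ i0 j0 : Fin N0,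
          ∑ s, q s * U s (Fin.castLE hle i0) (Fin.castLE hle j0)
            = A (Fin.castLE hle i0) (Fin.castLE hle j0)},
          (∀ q' ∈ {q' : EuclideanSpace ℝ (Fin S) | ∀ i0 j0 : Fin N0,
            ∑ s, q' s * U s (Fin.castLE hle i0) (Fin.castLE hle j0)
              = A (Fin.castLE hle i0) (Fin.castLE hle j0)}, ‖q‖ ≤ ‖q'‖) → q = qhat) ∧
        (∀ i j : Fin N, ∑ s, qhat s * U s i j = A i j) := by
  classical
  let T : Finset ℝ := insert 0 (Finset.univ.image fun p : Fin N × Fin N => A p.1 p.2)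
  let v : Fin T.card → ℝ := fun s => (T.equivFin.symm s : ℝ)
  have hv : Function.Injective v := Subtype.val_injective.comp T.equivFin.symm.injective
  have hsurj : ∀ i j, ∃ s, v s = A i j := fun i j =>
    ⟨T.equivFin ⟨A i j, Finset.mem_insert_of_mem
      (Finset.mem_image_of_mem (fun p : Fin N × Fin N => A p.1 p.2) (Finset.mem_univ (i, j)))⟩,
      by simp [v]⟩
  have hmem : ∀ s, v s ≠ 0 → ∃ i j, A i j = v s := by
    intro s hs
    have h := (T.equivFin.symm s).2
    rcases Finset.mem_insert.1 h with h | h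
    · exact absurd h hs
    · obtain ⟨p, -, hp⟩ := Finset.mem_image.1 h
      exact ⟨p.1, p.2, hp⟩
  let U : Fin T.card → Fin N → Fin N → ℝ := fun s i j =>
    if v s ≠ 0 ∧ A i j = v s then 1 else 0
  let qhat : EuclideanSpace ℝ (Fin T.card) := WithLp.toLp 2 v
  have hrec : ∀ i j, ∑ s, qhat s * U s i j = A i j := by
    intro i j
    obtain ⟨s, hs⟩ := hsurj i j
    by_cases h : v s = 0
    · rw [← hs, h]
      refine Finset.sum_eq_zero fun t _ => ?_
      have : ¬ (v t ≠ 0 ∧ A i j = v t) := fun ht => ht.1 (by rw [← ht.2, ← hs, h])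
      simp only [U, if_neg this, mul_zero]
    · simp only [U, ← hs]
      exact sum_mul_level_indicator hv v h
  have hforced : ∀ q : EuclideanSpace ℝ (Fin T.card), (∀ i0 j0 : Fin N0,
      ∑ s, q s * U s (Fin.castLE hle i0) (Fin.castLE hle j0)
        = A (Fin.castLE hle i0) (Fin.castLE hle j0)) → ∀ s, v s ≠ 0 → q s = v s := by
    intro q hq s hs
    obtain ⟨i, j, hij⟩ := hmem s hs
    obtain ⟨i0, j0, h⟩ := hval i j (hij ▸ hs)
    have hqs := hq i0 j0
    simp only [U, h.trans hij] at hqs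
    rwa [sum_mul_level_indicator hv q hs] at hqs
  have hdom : ∀ q : EuclideanSpace ℝ (Fin T.card), (∀ i0 j0 : Fin N0,
      ∑ s, q s * U s (Fin.castLE hle i0) (Fin.castLE hle j0)
        = A (Fin.castLE hle i0) (Fin.castLE hle j0)) → ∀ s, |qhat s| ≤ |q s| := by
    intro q hq s
    change |v s| ≤ |q s|
    by_cases hs : v s = 0
    · simp [hs]
    · rw [hforced q hq s hs]
  have hqhat : ∀ i0 j0 : Fin N0, ∑ s, qhat s * U s (Fin.castLE hle i0) (Fin.castLE hle j0)
      = A (Fin.castLE hle i0) (Fin.castLE hle j0) := fun _ _ => hrec _ _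
  refine ⟨T.card, Finset.card_pos.2 ⟨0, Finset.mem_insert_self _ _⟩, U, ?_, ?_, ?_, qhat, hqhat,
    ?_, ?_, hrec⟩
  · intro s i j hij
    simp only [U, hA i j hij]
    exact if_neg fun h => h.1 h.2.symm
  · intro s i j
    exact (ite_eq_or_eq _ _ _).symm
  · rintro s s' hss' i j ⟨h, h'⟩
    simp only [U, ite_eq_left_iff, zero_ne_one, imp_false, not_not] at h h'
    exact hss' (hv (h.2.symm.trans h'.2))
  · intro q hq
    rw [EuclideanSpace.norm_eq, EuclideanSpace.norm_eq]
    gcongr with s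
    exact hdom q hq s
  · intro q hq hmin
    ext s
    change q s = v s
    by_cases hs : v s = 0
    · have h := EuclideanSpace.sq_eq_sq_of_abs_le_of_norm_le (hdom q hq) (hmin qhat hqhat) s
      change v s ^ 2 = q s ^ 2 at h
      rw [hs, zero_pow two_ne_zero] at h
      rw [hs]
      exact pow_eq_zero_iff two_ne_zero |>.1 h.symm
    · exact hforced q hq s hs
end
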